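/- arXiv:2005.05965 — 2 statements merged into one kernel-verified Lean document; each statement's English description precedes it below -/
import Mathlib

section
/- Let B be a symmetric n×n real matrix with B ≠ 0, let P be a symmetric n×n real matrix with P² = P (an orthogonal projection), let g ∈ ℝⁿ and set p = Pg. Let τ > 0 be such that τI + B is positive definite and τI + B − PᵀBP is positive definite, and let d ∈ ℝⁿ be the solution of (τI + B)d = −p. Let q(x) = f₀ + (x − x₀)ᵀg + ½(x − x₀)ᵀB(x − x₀) be the quadratic model centered at x₀ ∈ ℝⁿ (f₀ ∈ ℝ). Then q(x₀) − q(x₀ + Pd) ≥ ½‖p‖ · min{‖Pd‖, ‖p‖/(3‖B‖)}, where ‖·‖ denotes the Euclidean vector norm and ‖B‖ the operator 2-norm. -/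
open Matrix
noncomputable def vecNorm {n : ℕ} (x : Fin n → ℝ) : ℝ :=
  ‖(WithLp.equiv 2 (Fin n → ℝ)).symm x‖

noncomputable def matNorm {n : ℕ} (M : Matrix (Fin n) (Fin n) ℝ) : ℝ :=
  ‖Matrix.toEuclideanCLM (𝕜 := ℝ) M‖

theorem vecNorm_nonneg {n : ℕ} (x : Fin n → ℝ) : 0 ≤ vecNorm x := norm_nonneg _

theorem vecNorm_sq {n : ℕ} (x : Fin n → ℝ) : vecNorm x ^ 2 = x ⬝ᵥ x := by
  rw [vecNorm, EuclideanSpace.norm_sq_eq]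
  simp [dotProduct, sq]

theorem dotProduct_le_vecNorm_mul {n : ℕ} (x y : Fin n → ℝ) :
    x ⬝ᵥ y ≤ vecNorm x * vecNorm y := by
  have h := real_inner_le_norm ((WithLp.equiv 2 (Fin n → ℝ)).symm y)
    ((WithLp.equiv 2 (Fin n → ℝ)).symm x)
  rw [EuclideanSpace.inner_eq_star_dotProduct] at h
  simpa [vecNorm, mul_comm] using h

theorem matNorm_pos {n : ℕ} {M : Matrix (Fin n) (Fin n) ℝ} (hM : M ≠ 0) : 0 < matNorm M :=
  norm_pos_iff.mpr ((map_ne_zero_iff _ (Matrix.toEuclideanCLM (𝕜 := ℝ)).injective).mpr hM)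

theorem vecNorm_mulVec_le {n : ℕ} (M : Matrix (Fin n) (Fin n) ℝ) (x : Fin n → ℝ) :
    vecNorm (M *ᵥ x) ≤ matNorm M * vecNorm x :=
  (Matrix.toEuclideanCLM (𝕜 := ℝ) M).le_opNorm ((WithLp.equiv 2 (Fin n → ℝ)).symm x)

theorem dotProduct_mulVec_self_le {n : ℕ} (M : Matrix (Fin n) (Fin n) ℝ) (x : Fin n → ℝ) :
    x ⬝ᵥ (M *ᵥ x) ≤ matNorm M * vecNorm x ^ 2 := by
  nlinarith [dotProduct_le_vecNorm_mul x (M *ᵥ x), vecNorm_mulVec_le M x, vecNorm_nonneg x]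

theorem dotProduct_mulVec_comm_of_isSymm {n : ℕ} {M : Matrix (Fin n) (Fin n) ℝ}
    (hM : M.IsSymm) (x y : Fin n → ℝ) : x ⬝ᵥ (M *ᵥ y) = (M *ᵥ x) ⬝ᵥ y := by
  rw [dotProduct_mulVec, ← mulVec_transpose, hM.eq]

/-- If `A` is positive semidefinite and bounded by `c` at `A d`, then `‖A d‖² ≤ c dᵀ A d`. -/
theorem dotProduct_mulVec_self_le_of_posSemidef {n : ℕ} {A : Matrix (Fin n) (Fin n) ℝ}
    (hA : A.PosSemidef) {c : ℝ} (hc : 0 < c) (d : Fin n → ℝ)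
    (hAc : (A *ᵥ d) ⬝ᵥ (A *ᵥ (A *ᵥ d)) ≤ c * ((A *ᵥ d) ⬝ᵥ (A *ᵥ d))) :
    (A *ᵥ d) ⬝ᵥ (A *ᵥ d) ≤ c * (d ⬝ᵥ (A *ᵥ d)) := by
  have hsymm : A.IsSymm := by simpa [Matrix.IsHermitian, Matrix.IsSymm] using hA.isHermitian
  have h := hA.dotProduct_mulVec_nonneg (c • d - A *ᵥ d)
  have hcomm := dotProduct_mulVec_comm_of_isSymm hsymm d (A *ᵥ d)
  simp only [star_trivial, mulVec_sub, mulVec_smul, dotProduct_sub, sub_dotProduct,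
    dotProduct_smul, smul_dotProduct, smul_eq_mul, hcomm] at h
  nlinarith

/-- Scalar form of the model decrease bound when the shift `τ` is at least `2 * b`. -/
theorem half_mul_mul_le_of_two_mul_le {τ b r s p β w σ : ℝ} (hτ : 0 < τ) (hb : 0 ≤ b)
    (hbτ : 2 * b ≤ τ) (hsr : s ^ 2 ≤ r ^ 2)
    (hp : p ^ 2 = τ ^ 2 * r ^ 2 + 2 * τ * β + w ^ 2) (hw : w ^ 2 ≤ b ^ 2 * r ^ 2)
    (hσ : σ ≤ b * s ^ 2) :
    1 / 2 * p * s ≤ τ * r ^ 2 + β - 1 / 2 * σ := by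
  have hcoef : 0 ≤ (τ - 2 * b) * (3 * τ + 2 * b) * s ^ 2 := by
    have : 0 ≤ τ - 2 * b := by linarith
    positivity
  have hτb : 0 ≤ (τ ^ 2 - b ^ 2) * (r ^ 2 - s ^ 2) :=
    mul_nonneg (by nlinarith) (by linarith)
  have hτσ := mul_le_mul_of_nonneg_left hσ hτ.le
  refine le_of_mul_le_mul_left ?_ hτ
  nlinarith [sq_nonneg (2 * p - τ * s)]

/-- lower bound on the predicted reduction of the quadratic model. -/
theorem predicted_reduction_lower_bound {n : ℕ}
    (B : Matrix (Fin n) (Fin n) ℝ) (hBsymm : B.IsSymm) (hBne : B ≠ 0)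
    (P : Matrix (Fin n) (Fin n) ℝ) (hPsymm : P.IsSymm) (hPidem : P * P = P)
    (g : Fin n → ℝ) (p : Fin n → ℝ) (hp : p = P *ᵥ g)
    (τ : ℝ) (hτ : 0 < τ)
    (hpd1 : (τ • (1 : Matrix (Fin n) (Fin n) ℝ) + B).PosDef)
    (hpd2 : (τ • (1 : Matrix (Fin n) (Fin n) ℝ) + B - Pᵀ * B * P).PosDef)
    (d : Fin n → ℝ) (hd : (τ • (1 : Matrix (Fin n) (Fin n) ℝ) + B) *ᵥ d = -p)
    (x₀ : Fin n → ℝ) (f₀ : ℝ)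
    (q : (Fin n → ℝ) → ℝ)
    (hq : ∀ x, q x = f₀ + (x - x₀) ⬝ᵥ g + (1 / 2) * ((x - x₀) ⬝ᵥ (B *ᵥ (x - x₀)))) :
    q x₀ - q (x₀ + P *ᵥ d) ≥
      (1 / 2) * vecNorm p * min (vecNorm (P *ᵥ d)) (vecNorm p / (3 * matNorm B)) := by
  have hb := matNorm_pos hBne
  have hsymmP := dotProduct_mulVec_comm_of_isSymm hPsymm
  have hAx (x : Fin n → ℝ) :
      (τ • (1 : Matrix (Fin n) (Fin n) ℝ) + B) *ᵥ x = τ • x + B *ᵥ x := by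
    rw [add_mulVec, smul_mulVec, one_mulVec]
  have hpp : p ⬝ᵥ p = τ ^ 2 * (d ⬝ᵥ d) + 2 * τ * (d ⬝ᵥ (B *ᵥ d)) + (B *ᵥ d) ⬝ᵥ (B *ᵥ d) := by
    rw [← neg_dotProduct_neg p p, ← hd, hAx]
    simp only [dotProduct_add, add_dotProduct, dotProduct_smul, smul_dotProduct, smul_eq_mul,
      dotProduct_comm (B *ᵥ d) d]
    ring
  have hdA : d ⬝ᵥ ((τ • (1 : Matrix (Fin n) (Fin n) ℝ) + B) *ᵥ d) =
      τ * (d ⬝ᵥ d) + d ⬝ᵥ (B *ᵥ d) := by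
    rw [hAx, dotProduct_add, dotProduct_smul, smul_eq_mul]
  have hsg : (P *ᵥ d) ⬝ᵥ g = -(τ * (d ⬝ᵥ d) + d ⬝ᵥ (B *ᵥ d)) := by
    rw [← hsymmP, ← hp, ← hdA, hd, dotProduct_neg, neg_neg]
  have hpred : q x₀ - q (x₀ + P *ᵥ d) = τ * (d ⬝ᵥ d) + d ⬝ᵥ (B *ᵥ d) -
      1 / 2 * ((P *ᵥ d) ⬝ᵥ (B *ᵥ (P *ᵥ d))) := by
    rw [hq, hq, add_sub_cancel_left, hsg, sub_self, zero_dotProduct, zero_dotProduct]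
    ring
  have hp0 := vecNorm_nonneg p
  rw [ge_iff_le, hpred]
  rcases le_total (2 * matNorm B) τ with h | h
  · have hPd : (P *ᵥ d) ⬝ᵥ (P *ᵥ d) = d ⬝ᵥ (P *ᵥ d) := by
      rw [← hsymmP, mulVec_mulVec, hPidem]
    have hsd : vecNorm (P *ᵥ d) ^ 2 ≤ vecNorm d ^ 2 := by
      have := vecNorm_sq (d - P *ᵥ d)
      simp only [dotProduct_sub, sub_dotProduct, hPd, dotProduct_comm (P *ᵥ d) d] at this
      rw [vecNorm_sq, vecNorm_sq, hPd]
      nlinarith [sq_nonneg (vecNorm (d - P *ᵥ d))]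
    have hBd : vecNorm (B *ᵥ d) ^ 2 ≤ matNorm B ^ 2 * vecNorm d ^ 2 := by
      rw [← mul_pow]
      exact pow_le_pow_left₀ (vecNorm_nonneg _) (vecNorm_mulVec_le B d) 2
    simp only [← vecNorm_sq] at hpp ⊢
    refine (mul_le_mul_of_nonneg_left (min_le_left _ _) (by positivity)).trans ?_
    exact half_mul_mul_le_of_two_mul_le hτ hb.le h hsd hpp hBd
      (dotProduct_mulVec_self_le B (P *ᵥ d))
  · have hmain := dotProduct_mulVec_self_le_of_posSemidef hpd1.posSemidef
      (c := 3 * matNorm B) (by positivity) d (by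
        rw [hAx ((τ • (1 : Matrix (Fin n) (Fin n) ℝ) + B) *ᵥ d), dotProduct_add,
          dotProduct_smul, smul_eq_mul]
        have h1 := dotProduct_mulVec_self_le B ((τ • (1 : Matrix (Fin n) (Fin n) ℝ) + B) *ᵥ d)
        rw [← vecNorm_sq]
        nlinarith [sq_nonneg (vecNorm ((τ • (1 : Matrix (Fin n) (Fin n) ℝ) + B) *ᵥ d))])
    rw [hdA, hd, neg_dotProduct_neg, ← vecNorm_sq] at hmain
    have hpos := hpd2.posSemidef.dotProduct_mulVec_nonneg d
    rw [star_trivial, sub_mulVec, dotProduct_sub, hdA, hPsymm.eq, ← mulVec_mulVec,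
      ← mulVec_mulVec, hsymmP] at hpos
    have hdiv : vecNorm p * (vecNorm p / (3 * matNorm B)) ≤
        τ * (d ⬝ᵥ d) + d ⬝ᵥ (B *ᵥ d) := by
      rw [← mul_div_assoc, div_le_iff₀ (by positivity)]
      linarith
    have hmin := mul_le_mul_of_nonneg_left
      (min_le_right (vecNorm (P *ᵥ d)) (vecNorm p / (3 * matNorm B))) hp0
    linarith
end

section
/- Let B be a symmetric n×n real matrix, P a symmetric n×n real matrix with P² = P, g ∈ ℝⁿ, p = Pg, and τ ∈ ℝ such that τI + B is invertible. Let d solve (τI + B)d = −p, and let q(x) = f₀ + (x − x₀)ᵀg + ½(x − x₀)ᵀB(x − x₀). Then q(x₀) − q(x₀ + Pd) = ½( pᵀ(τI + B)⁻¹p + dᵀ(τI + B − PᵀBP)d ). -/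
open Matrix

/-- exact expression for the predicted reduction of the quadratic model. -/
theorem predicted_reduction_identity {n : ℕ}
    (B : Matrix (Fin n) (Fin n) ℝ) (hBsymm : B.IsSymm)
    (P : Matrix (Fin n) (Fin n) ℝ) (hPsymm : P.IsSymm) (hPidem : P * P = P)
    (g : Fin n → ℝ) (p : Fin n → ℝ) (hp : p = P *ᵥ g)
    (τ : ℝ) (hinv : IsUnit (τ • (1 : Matrix (Fin n) (Fin n) ℝ) + B))
    (d : Fin n → ℝ) (hd : (τ • (1 : Matrix (Fin n) (Fin n) ℝ) + B) *ᵥ d = -p)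
    (x₀ : Fin n → ℝ) (f₀ : ℝ)
    (q : (Fin n → ℝ) → ℝ)
    (hq : ∀ x, q x = f₀ + (x - x₀) ⬝ᵥ g + (1 / 2) * ((x - x₀) ⬝ᵥ (B *ᵥ (x - x₀)))) :
    q x₀ - q (x₀ + P *ᵥ d) =
      (1 / 2) * (p ⬝ᵥ ((τ • (1 : Matrix (Fin n) (Fin n) ℝ) + B)⁻¹ *ᵥ p)
        + d ⬝ᵥ ((τ • (1 : Matrix (Fin n) (Fin n) ℝ) + B - Pᵀ * B * P) *ᵥ d)) := by
  have hinv_p : (τ • (1 : Matrix (Fin n) (Fin n) ℝ) + B)⁻¹ *ᵥ p = -d := by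
    rw [← neg_eq_iff_eq_neg.mpr hd, mulVec_neg, mulVec_mulVec,
      nonsing_inv_mul _ ((isUnit_iff_isUnit_det _).mp hinv), one_mulVec]
  have hlin : (P *ᵥ d) ⬝ᵥ g = d ⬝ᵥ p := by
    rw [hp, dotProduct_mulVec, ← mulVec_transpose, hPsymm.eq]
  have hquad : d ⬝ᵥ ((Pᵀ * B * P) *ᵥ d) = (P *ᵥ d) ⬝ᵥ (B *ᵥ (P *ᵥ d)) := by
    rw [← mulVec_mulVec, ← mulVec_mulVec, dotProduct_mulVec, ← mulVec_transpose,
      transpose_transpose]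
  rw [hq, hq, hinv_p, sub_mulVec, dotProduct_sub, hd, hquad, sub_self, add_sub_cancel_left, hlin,
    zero_dotProduct, zero_dotProduct, dotProduct_neg, dotProduct_neg, dotProduct_comm p d]
  ring
end
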